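/- Let V = ℂ^n with n ≥ 6, basis e₁,…,e_n, and write e_{i,j,k} = e_i ∧ e_j ∧ e_k ∈ ⋀³V. Define the symmetric bilinear map ξ : S²(⋀²(⋀³V)) → ⋀⁶V ⊗ ⋀²(⋀³V) on generators by ξ((e_{i,j,k} ∧ e_{l,m,p}) · (e_{o,p',q} ∧ e_{r,s,t})) = (e_i∧e_j∧e_k∧e_l∧e_m∧e_p) ⊗ (e_{o,p',q} ∧ e_{r,s,t}) + (e_o∧e_{p'}∧e_q∧e_r∧e_s∧e_t) ⊗ (e_{i,j,k} ∧ e_{l,m,p}). Let w₆ = Σ_{σ∈S₆} sgn(σ)· e_{σ(1),σ(2),σ(3)} ∧ e_{σ(4),σ(5),σ(6)} and let Ψ∨(a∧b∧c∧d) = (a∧b)·(c∧d) − (a∧c)·(b∧d) + (a∧d)·(b∧c) for a,b,c,d ∈ ⋀³V. Then ξ(Ψ∨(w₆ ∧ w₆)) = 1296 · (e₁∧⋯∧e₆) ⊗ w₆; in particular it is nonzero. -/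

import Mathlib

set_option synthInstance.maxHeartbeats 1000000
set_option maxHeartbeats 1000000

open ExteriorAlgebra TensorProduct

/-- The symmetric square `S²M` of a module, as a quotient of `M ⊗ M`. -/
abbrev SymSq (K M : Type*) [Field K] [AddCommGroup M] [Module K M] :=
  (M ⊗[K] M) ⧸ (Submodule.span K {z : M ⊗[K] M | ∃ x y : M, z = x ⊗ₜ[K] y - y ⊗ₜ[K] x})

/-- The symmetric product `x · y ∈ S²M`. -/
noncomputable def symMul {K M : Type*} [Field K] [AddCommGroup M] [Module K M] (x y : M) :
    SymSq K M :=
  Submodule.Quotient.mk (x ⊗ₜ[K] y)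

/-- The wedge `v₀ ∧ ⋯ ∧ v_{m-1}` as an element of the submodule `⋀[K]^m V`. -/
noncomputable def wedgePow (K V : Type*) [Field K] [AddCommGroup V] [Module K V]
    (m : ℕ) (v : Fin m → V) : ⋀[K]^m V :=
  ⟨ιMulti K m v, ιMulti_range K m (Set.mem_range_self v)⟩

/-- The `i`-th standard basis vector of `ℂⁿ` (`0`-indexed). -/
noncomputable def basV (n i : ℕ) : Fin n → ℂ := fun t => if (t : ℕ) = i then 1 else 0

/-- `e_{i,j,k} ∧ e_{l,m,p} ∈ ⋀²(⋀³ℂⁿ)` for `x, y ∈ ⋀³ℂⁿ`. -/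
noncomputable def wedgeTwo (n : ℕ) (x y : ⋀[ℂ]^3 (Fin n → ℂ)) :
    ⋀[ℂ]^2 (⋀[ℂ]^3 (Fin n → ℂ)) :=
  wedgePow ℂ (⋀[ℂ]^3 (Fin n → ℂ)) 2 ![x, y]

/-- The multiplication `⋀³ℂⁿ ⊗ ⋀³ℂⁿ → ⋀⁶ℂⁿ`. -/
noncomputable def mulSix (n : ℕ) (x y : ⋀[ℂ]^3 (Fin n → ℂ)) : ⋀[ℂ]^6 (Fin n → ℂ) :=
  ⟨(x : ExteriorAlgebra ℂ (Fin n → ℂ)) * y, by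
    rw [show (6 : ℕ) = 3 + 3 from rfl, exteriorPower, pow_add]
    exact Submodule.mul_mem_mul x.2 y.2⟩

/-- `e_{σ(1)} ∧ e_{σ(2)} ∧ e_{σ(3)} ∈ ⋀³ℂⁿ`. -/
noncomputable def triA (n : ℕ) (σ : Equiv.Perm (Fin 6)) : ⋀[ℂ]^3 (Fin n → ℂ) :=
  wedgePow ℂ (Fin n → ℂ) 3 ![basV n (σ 0 : Fin 6), basV n (σ 1 : Fin 6), basV n (σ 2 : Fin 6)]

/-- `e_{σ(4)} ∧ e_{σ(5)} ∧ e_{σ(6)} ∈ ⋀³ℂⁿ`. -/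
noncomputable def triB (n : ℕ) (σ : Equiv.Perm (Fin 6)) : ⋀[ℂ]^3 (Fin n → ℂ) :=
  wedgePow ℂ (Fin n → ℂ) 3 ![basV n (σ 3 : Fin 6), basV n (σ 4 : Fin 6), basV n (σ 5 : Fin 6)]

/-- `w₆ ∧ w₆ ∈ ⋀⁴(⋀³ℂⁿ)`. -/
noncomputable def wSixSq (n : ℕ) : ⋀[ℂ]^4 (⋀[ℂ]^3 (Fin n → ℂ)) :=
  ∑ σ : Equiv.Perm (Fin 6), ∑ τ : Equiv.Perm (Fin 6),
    (((Equiv.Perm.sign σ * Equiv.Perm.sign τ : ℤˣ) : ℤ) : ℂ) •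
      wedgePow ℂ (⋀[ℂ]^3 (Fin n → ℂ)) 4 ![triA n σ, triB n σ, triA n τ, triB n τ]

/-- `w₆ = Σ_σ sgn(σ) e_{σ(1),σ(2),σ(3)} ∧ e_{σ(4),σ(5),σ(6)} ∈ ⋀²(⋀³ℂⁿ)`. -/
noncomputable def wSixTwo (n : ℕ) : ⋀[ℂ]^2 (⋀[ℂ]^3 (Fin n → ℂ)) :=
  ∑ σ : Equiv.Perm (Fin 6),
    (((Equiv.Perm.sign σ : ℤˣ) : ℤ) : ℂ) • wedgeTwo n (triA n σ) (triB n σ)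

/-- `e₁ ∧ ⋯ ∧ e₆ ∈ ⋀⁶ℂⁿ`. -/
noncomputable def topSix (n : ℕ) : ⋀[ℂ]^6 (Fin n → ℂ) :=
  wedgePow ℂ (Fin n → ℂ) 6 ![basV n 0, basV n 1, basV n 2, basV n 3, basV n 4, basV n 5]

namespace XiPsi

/-- The sign as a complex number. -/
noncomputable def sg {m : ℕ} (σ : Equiv.Perm (Fin m)) : ℂ := (((Equiv.Perm.sign σ : ℤˣ) : ℤ) : ℂ)

lemma sg_mul {m : ℕ} (σ τ : Equiv.Perm (Fin m)) : sg (σ * τ) = sg σ * sg τ := by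
  simp [sg]

lemma sg_sq {m : ℕ} (σ : Equiv.Perm (Fin m)) : sg σ * sg σ = 1 := by
  unfold sg
  rw [← Int.cast_mul, ← Units.val_mul, Int.units_mul_self]
  simp

lemma wedgePow_eq (K V : Type*) [Field K] [AddCommGroup V] [Module K V]
    (m : ℕ) (v : Fin m → V) : wedgePow K V m v = exteriorPower.ιMulti K m v := rfl

lemma wedgePow_perm (V : Type*) [AddCommGroup V] [Module ℂ V]
    (m : ℕ) (v : Fin m → V) (σ : Equiv.Perm (Fin m)) :
    wedgePow ℂ V m (v ∘ σ) = sg σ • wedgePow ℂ V m v := by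
  rw [wedgePow_eq, wedgePow_eq, AlternatingMap.map_perm]
  rcases Int.units_eq_one_or (Equiv.Perm.sign σ) with h | h
  · simp [sg, h]
  · simp only [sg, h]
    rw [Units.neg_smul, one_smul]
    push_cast
    module

lemma triA_eq (n : ℕ) (σ : Equiv.Perm (Fin 6)) :
    triA n σ = wedgePow ℂ _ 3 (fun i => basV n (σ (Fin.castAdd 3 i) : Fin 6)) := by
  unfold triA; congr 1; funext i; fin_cases i <;> rfl

lemma triB_eq (n : ℕ) (σ : Equiv.Perm (Fin 6)) :
    triB n σ = wedgePow ℂ _ 3 (fun i => basV n (σ (Fin.natAdd 3 i) : Fin 6)) := by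
  unfold triB; congr 1; funext i; fin_cases i <;> rfl

lemma mulSix_wedge (n : ℕ) (a b : Fin 3 → (Fin n → ℂ)) :
    mulSix n (wedgePow ℂ _ 3 a) (wedgePow ℂ _ 3 b) = wedgePow ℂ _ 6 (Fin.append a b) := by
  apply Subtype.ext
  have h : ∀ v : Fin 6 → (Fin n → ℂ), ∀ a b : Fin 3 → (Fin n → ℂ),
      v 0 = a 0 → v 1 = a 1 → v 2 = a 2 → v 3 = b 0 → v 4 = b 1 → v 5 = b 2 →
      ιMulti ℂ 3 a * ιMulti ℂ 3 b = ιMulti ℂ 6 v := by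
    intro v a b h0 h1 h2 h3 h4 h5
    simp only [ιMulti_apply]
    simp [List.ofFn_succ, Fin.succ, mul_assoc]
    simp [← h0, ← h1, ← h2, ← h3, ← h4, ← h5]
  exact h _ _ _ rfl rfl rfl rfl rfl rfl

lemma topSix_eq (n : ℕ) : topSix n = wedgePow ℂ _ 6 (fun i : Fin 6 => basV n i) := by
  unfold topSix; congr 1; funext i; fin_cases i <;> rfl

lemma mulAB (n : ℕ) (σ : Equiv.Perm (Fin 6)) :
    mulSix n (triA n σ) (triB n σ) = sg σ • topSix n := by
  rw [triA_eq, triB_eq, mulSix_wedge, topSix_eq, ← wedgePow_perm]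
  congr 1; funext i; fin_cases i <;> rfl

/-- block swap -/
def bs : Equiv.Perm (Fin 6) := ⟨fun i => i + 3, fun i => i + 3, by decide, by decide⟩

lemma sg_bs : sg bs = -1 := by
  have : Equiv.Perm.sign bs = -1 := by decide
  simp [sg, this]

lemma triA_bs (n : ℕ) (σ : Equiv.Perm (Fin 6)) : triA n (σ * bs) = triB n σ := rfl
lemma triB_bs (n : ℕ) (σ : Equiv.Perm (Fin 6)) : triB n (σ * bs) = triA n σ := rfl

lemma mulSix_smul (n : ℕ) (a b : ℂ) (x y : ⋀[ℂ]^3 (Fin n → ℂ)) :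
    mulSix n (a • x) (b • y) = (a * b) • mulSix n x y := by
  apply Subtype.ext
  simp [mulSix, smul_smul, mul_comm]

lemma wedgeTwo_smul_right (n : ℕ) (a : ℂ) (x y : ⋀[ℂ]^3 (Fin n → ℂ)) :
    wedgeTwo n x (a • y) = a • wedgeTwo n x y := by
  have := (exteriorPower.ιMulti ℂ 2 (M := ⋀[ℂ]^3 (Fin n → ℂ))).map_update_smul ![x, y] 1 a y
  have e : ∀ z, Function.update ![x, y] 1 z = ![x, z] := by
    intro z; funext i; fin_cases i <;> rfl
  rw [e, e] at this
  exact this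

lemma wedgeTwo_swap (n : ℕ) (x y : ⋀[ℂ]^3 (Fin n → ℂ)) :
    wedgeTwo n x y = - wedgeTwo n y x := by
  have := (exteriorPower.ιMulti ℂ 2 (M := ⋀[ℂ]^3 (Fin n → ℂ))).map_swap ![y, x]
    (i := 0) (j := 1) (by decide)
  rw [wedgeTwo, wedgeTwo, wedgePow_eq, wedgePow_eq, ← this]
  congr 1; funext i; fin_cases i <;> rfl

/-- block permutations -/
def blk (p : Equiv.Perm (Fin 3) × Equiv.Perm (Fin 3)) : Equiv.Perm (Fin 6) :=
  finSumFinEquiv.permCongr (Equiv.Perm.sumCongr p.1 p.2)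

lemma blk_l (p : Equiv.Perm (Fin 3) × Equiv.Perm (Fin 3)) (i : Fin 3) :
    blk p (Fin.castAdd 3 i) = Fin.castAdd 3 (p.1 i) := by
  rw [blk, Equiv.permCongr_apply, ← finSumFinEquiv_apply_left, Equiv.symm_apply_apply]
  rfl

lemma blk_r (p : Equiv.Perm (Fin 3) × Equiv.Perm (Fin 3)) (i : Fin 3) :
    blk p (Fin.natAdd 3 i) = Fin.natAdd 3 (p.2 i) := by
  rw [blk, Equiv.permCongr_apply, ← finSumFinEquiv_apply_right, Equiv.symm_apply_apply]
  rfl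

lemma blk_inj : Function.Injective blk := by
  intro p q h
  have h' := finSumFinEquiv.permCongr.injective h
  exact Equiv.Perm.sumCongrHom_injective (α := Fin 3) (β := Fin 3) h'

lemma sg_blk (p : Equiv.Perm (Fin 3) × Equiv.Perm (Fin 3)) : sg (blk p) = sg p.1 * sg p.2 := by
  simp [sg, blk, Equiv.Perm.sign_permCongr, Equiv.Perm.sign_sumCongr]

lemma triA_blk (n : ℕ) (σ : Equiv.Perm (Fin 6)) (p) :
    triA n (σ * blk p) = sg p.1 • triA n σ := by
  rw [triA_eq, triA_eq, ← wedgePow_perm]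
  congr 1; funext i; simp only [Equiv.Perm.mul_apply, blk_l, Function.comp]

lemma triB_blk (n : ℕ) (σ : Equiv.Perm (Fin 6)) (p) :
    triB n (σ * blk p) = sg p.2 • triB n σ := by
  rw [triB_eq, triB_eq, ← wedgePow_perm]
  congr 1; funext i; simp only [Equiv.Perm.mul_apply, blk_r, Function.comp]

lemma exists_of_not_blk (ρ : Equiv.Perm (Fin 6)) (h : ρ ∉ Set.range blk) :
    ∃ i j : Fin 3, ρ (Fin.natAdd 3 i) = Fin.castAdd 3 j := by
  by_contra! hc
  apply h
  let ρ' : Equiv.Perm (Fin 3 ⊕ Fin 3) := finSumFinEquiv.symm.permCongr ρ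
  have hr : Set.MapsTo ρ' (Set.range Sum.inr) (Set.range Sum.inr) := by
    rintro _ ⟨i, rfl⟩
    rcases hx : ρ' (Sum.inr i) with j | j
    · exfalso
      apply hc i j
      have := congrArg finSumFinEquiv hx
      rw [← finSumFinEquiv_apply_right, ← finSumFinEquiv_apply_left, ← this]
      simp [ρ', Equiv.permCongr_apply]
    · exact ⟨j, rfl⟩
  have hl := (Equiv.Perm.perm_mapsTo_inl_iff_mapsTo_inr ρ').2 hr
  obtain ⟨p, hp⟩ := Equiv.Perm.mem_sumCongrHom_range_of_perm_mapsTo_inl hl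
  refine ⟨p, ?_⟩
  have : Equiv.Perm.sumCongr p.1 p.2 = ρ' := hp
  rw [blk, this]
  ext x
  simp [ρ', Equiv.permCongr_apply]

lemma mul_zero_of_not_blk (n : ℕ) (σ ρ : Equiv.Perm (Fin 6)) (h : ρ ∉ Set.range blk) :
    mulSix n (triA n σ) (triB n (σ * ρ)) = 0 := by
  obtain ⟨i, j, hij⟩ := exists_of_not_blk ρ h
  rw [triA_eq, triB_eq, mulSix_wedge, wedgePow_eq]
  apply AlternatingMap.map_eq_zero_of_eq _ _ (i := Fin.castAdd 3 j) (j := Fin.natAdd 3 i)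
  · rw [Fin.append_left, Fin.append_right, Equiv.Perm.mul_apply, hij]
  · intro h
    have := congrArg Fin.val h
    simp at this
    omega

abbrev TT (n : ℕ) := (⋀[ℂ]^6 (Fin n → ℂ)) ⊗[ℂ] (⋀[ℂ]^2 (⋀[ℂ]^3 (Fin n → ℂ)))

/-- mixed term -/
noncomputable def U (n : ℕ) (σ τ : Equiv.Perm (Fin 6)) : TT n :=
  (sg σ * sg τ) • (mulSix n (triA n σ) (triB n τ) ⊗ₜ[ℂ] wedgeTwo n (triB n σ) (triA n τ))

lemma scal {V W : Type*} [AddCommGroup V] [Module ℂ V] [AddCommGroup W] [Module ℂ W]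
    (x : V) (y : W) (s a b : ℂ) (hs : s * s = 1) (ha : a * a = 1) (hb : b * b = 1) :
    (s * (s * (a * b))) • ((b • s • x) ⊗ₜ[ℂ] (a • -y)) = (-1 : ℂ) • (x ⊗ₜ[ℂ] (s • y)) := by
  simp only [← TensorProduct.smul_tmul', TensorProduct.tmul_smul, TensorProduct.tmul_neg, smul_neg,
    smul_smul, ← neg_smul]
  congr 1
  linear_combination (-s * (a * a) * (b * b)) * hs - s * (b * b) * ha - s * hb

lemma sum_U_row (n : ℕ) (σ : Equiv.Perm (Fin 6)) :
    ∑ τ, U n σ τ = (-36 : ℂ) • (topSix n ⊗ₜ[ℂ] (sg σ • wedgeTwo n (triA n σ) (triB n σ))) := by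
  rw [← Equiv.sum_comp (Equiv.mulLeft σ)]
  have h1 : ∀ p, U n σ (σ * blk p) =
      (-1 : ℂ) • (topSix n ⊗ₜ[ℂ] (sg σ • wedgeTwo n (triA n σ) (triB n σ))) := by
    intro p
    have hB : mulSix n (triA n σ) (sg p.2 • triB n σ) = sg p.2 • sg σ • topSix n := by
      have := mulSix_smul n 1 (sg p.2) (triA n σ) (triB n σ)
      rw [one_smul, one_mul] at this
      rw [this, mulAB]
    rw [U, triA_blk, triB_blk, hB, wedgeTwo_smul_right, wedgeTwo_swap n (triB n σ), sg_mul, sg_blk]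
    exact scal _ _ _ _ _ (sg_sq σ) (sg_sq p.1) (sg_sq p.2)
  have h2 : ∑ p, U n σ (σ * blk p) = ∑ ρ, U n σ (Equiv.mulLeft σ ρ) := by
    apply Finset.sum_of_injOn blk blk_inj.injOn
    · intro x _; simp
    · intro ρ _ hρ
      rw [Equiv.coe_mulLeft, U, mul_zero_of_not_blk]
      · simp
      · simpa using hρ
    · intro p _; rfl
  rw [← h2]
  simp only [h1, Finset.sum_const, Finset.card_univ]
  rw [← Nat.cast_smul_eq_nsmul ℂ, smul_smul]
  congr 1
  simp [Fintype.card_prod, Fintype.card_perm, Nat.factorial]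

lemma sum_U (n : ℕ) : ∑ σ, ∑ τ, U n σ τ = (-36 : ℂ) • (topSix n ⊗ₜ[ℂ] wSixTwo n) := by
  simp only [sum_U_row, ← Finset.smul_sum, ← TensorProduct.tmul_sum]
  rfl

lemma card6 : (Fintype.card (Equiv.Perm (Fin 6)) : ℂ) = 720 := by
  simp [Fintype.card_perm, Nat.factorial]; try norm_num

lemma sum_mul (n : ℕ) : ∑ σ, sg σ • mulSix n (triA n σ) (triB n σ) = (720 : ℂ) • topSix n := by
  simp only [mulAB, smul_smul, sg_sq, one_smul, Finset.sum_const, Finset.card_univ]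
  rw [← Nat.cast_smul_eq_nsmul ℂ, card6]

lemma sum_bs {M : Type*} [AddCommMonoid M] (f : Equiv.Perm (Fin 6) → M) :
    ∑ σ, f (σ * bs) = ∑ σ, f σ := Equiv.sum_comp (Equiv.mulRight bs) f

lemma sum1 (n : ℕ) : ∑ σ, ∑ τ, (sg σ * sg τ) •
    (mulSix n (triA n σ) (triB n σ) ⊗ₜ[ℂ] wedgeTwo n (triA n τ) (triB n τ)) =
    (720 : ℂ) • (topSix n ⊗ₜ[ℂ] wSixTwo n) := by
  rw [TensorProduct.smul_tmul', ← sum_mul, TensorProduct.sum_tmul]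
  refine Finset.sum_congr rfl fun σ _ => ?_
  rw [wSixTwo, TensorProduct.tmul_sum]
  refine Finset.sum_congr rfl fun τ _ => ?_
  rw [TensorProduct.tmul_smul, ← TensorProduct.smul_tmul', smul_smul, mul_comm]
  rfl

lemma topSix_ne (n : ℕ) (hn : 6 ≤ n) : topSix n ≠ 0 := by
  intro h
  let f : (Fin n → ℂ) [⋀^Fin 6]→ₗ[ℂ] ℂ :=
    (Matrix.detRowAlternating (n := Fin 6) (R := ℂ)).compLinearMap (LinearMap.funLeft ℂ ℂ (Fin.castLE hn) : (Fin n → ℂ) →ₗ[ℂ] (Fin 6 → ℂ))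
  have h1 := congrArg (exteriorPower.alternatingMapLinearEquiv f) h
  rw [topSix_eq, wedgePow_eq, exteriorPower.alternatingMapLinearEquiv_apply_ιMulti, map_zero] at h1
  have h2 : f (fun i : Fin 6 => basV n i) = Matrix.det (1 : Matrix (Fin 6) (Fin 6) ℂ) := by
    have h3 : ∀ v, f v = Matrix.det (Matrix.of fun i j : Fin 6 => v i (Fin.castLE hn j)) := by
      intro v
      simp only [f]
      rw [AlternatingMap.compLinearMap_apply]
      refine congrArg (Matrix.detRowAlternating (n := Fin 6) (R := ℂ)) ?_
      funext i j
      rfl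
    rw [h3]
    congr 1
    ext i j
    simp [LinearMap.funLeft, basV, Matrix.one_apply, Fin.ext_iff, eq_comm]
  rw [h2, Matrix.det_one] at h1
  exact one_ne_zero h1

lemma wSix_ne (n : ℕ) (hn : 6 ≤ n) : wSixTwo n ≠ 0 := by
  intro h
  let X := ⋀[ℂ]^3 (Fin n → ℂ)
  let E := ExteriorAlgebra ℂ (Fin n → ℂ)
  let m : MultilinearMap ℂ (fun _ : Fin 2 => X) E :=
    (MultilinearMap.mkPiAlgebraFin ℂ 2 E).compLinearMap (fun _ => Submodule.subtype _)
  let f : X [⋀^Fin 2]→ₗ[ℂ] E := MultilinearMap.alternatization m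
  have hf : ∀ x y : X, exteriorPower.alternatingMapLinearEquiv f (wedgeTwo n x y) =
      ((mulSix n x y - mulSix n y x : ⋀[ℂ]^6 (Fin n → ℂ)) : E) := by
    intro x y
    rw [wedgeTwo, wedgePow_eq, exteriorPower.alternatingMapLinearEquiv_apply_ιMulti]
    have hu : (Finset.univ : Finset (Equiv.Perm (Fin 2))) = {1, Equiv.swap 0 1} := by decide
    simp only [f, MultilinearMap.alternatization_apply, hu]
    rw [Finset.sum_pair (by decide)]
    simp [m, mulSix, sub_eq_add_neg]
  have h1 := congrArg (exteriorPower.alternatingMapLinearEquiv f) h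
  rw [wSixTwo, map_zero, map_sum] at h1
  simp only [map_smul, hf] at h1
  have h2 : ∑ σ, sg σ • (mulSix n (triA n σ) (triB n σ) - mulSix n (triB n σ) (triA n σ)) = 0 := by
    apply Subtype.ext
    rw [AddSubmonoidClass.coe_finsetSum]
    exact h1
  have h3 : ∑ σ, sg σ • mulSix n (triB n σ) (triA n σ) = (-720 : ℂ) • topSix n := by
    have e : (-720 : ℂ) • topSix n = -((720 : ℂ) • topSix n) := by module
    rw [← sum_bs, e, ← sum_mul, ← Finset.sum_neg_distrib]
    refine Finset.sum_congr rfl fun σ _ => ?_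
    rw [sg_mul, sg_bs, triA_bs, triB_bs]
    module
  simp only [smul_sub, Finset.sum_sub_distrib, sum_mul, h3] at h2
  have e : (720 : ℂ) • topSix n - (-720 : ℂ) • topSix n = (1440 : ℂ) • topSix n := by module
  rw [e, smul_eq_zero] at h2
  rcases h2 with h2 | h2
  · norm_num at h2
  · exact topSix_ne n hn h2

lemma tmul_ne {V W : Type*} [AddCommGroup V] [Module ℂ V] [AddCommGroup W] [Module ℂ W]
    (x : V) (y : W) (hx : x ≠ 0) (hy : y ≠ 0) (c : ℂ) (hc : c ≠ 0) : c • (x ⊗ₜ[ℂ] y) ≠ 0 := by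
  refine smul_ne_zero hc ?_
  intro h
  rw [Ne, ← Module.forall_dual_apply_eq_zero_iff ℂ] at hx hy
  push Not at hx hy
  obtain ⟨f, hf⟩ := hx
  obtain ⟨g, hg⟩ := hy
  have := congrArg (fun z => TensorProduct.lid ℂ ℂ (TensorProduct.map f g z)) h
  simp [hf, hg] at this

lemma arith {T : Type*} [AddCommMonoid T] [Module ℂ T] (t a b c d e f : T)
    (ha : a = (720 : ℂ) • t) (hb : b = (720 : ℂ) • t) (hc : c = (-36 : ℂ) • t)
    (hd : d = (-36 : ℂ) • t) (he : e = (-36 : ℂ) • t) (hf : f = (-36 : ℂ) • t) :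
    (a + b) + (c + d) + (e + f) = (1296 : ℂ) • t := by
  subst ha hb hc hd he hf
  simp only [← add_smul]
  norm_num

end XiPsi

/-- Lemma A.3 of the paper: `ξ(Ψ∨(w₆ ∧ w₆)) = 1296 · (e₁∧⋯∧e₆) ⊗ w₆ ≠ 0`, where `Ψ∨` is the
comultiplication `⋀⁴(⋀³ℂⁿ) → S²(⋀²(⋀³ℂⁿ))` and `ξ` is induced by the wedge multiplication
`⋀³ℂⁿ ⊗ ⋀³ℂⁿ → ⋀⁶ℂⁿ` on the first symmetric factor. -/
theorem xi_psi_wSix_wedge_wSix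
    (n : ℕ) (hn : 6 ≤ n)
    (Ψ : ⋀[ℂ]^4 (⋀[ℂ]^3 (Fin n → ℂ)) →ₗ[ℂ] SymSq ℂ (⋀[ℂ]^2 (⋀[ℂ]^3 (Fin n → ℂ))))
    (hΨ : ∀ a b c d : ⋀[ℂ]^3 (Fin n → ℂ),
      Ψ (wedgePow ℂ (⋀[ℂ]^3 (Fin n → ℂ)) 4 ![a, b, c, d]) =
        symMul (wedgeTwo n a b) (wedgeTwo n c d)
          - symMul (wedgeTwo n a c) (wedgeTwo n b d)
          + symMul (wedgeTwo n a d) (wedgeTwo n b c))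
    (ξm : SymSq ℂ (⋀[ℂ]^2 (⋀[ℂ]^3 (Fin n → ℂ))) →ₗ[ℂ]
      (⋀[ℂ]^6 (Fin n → ℂ)) ⊗[ℂ] (⋀[ℂ]^2 (⋀[ℂ]^3 (Fin n → ℂ))))
    (hξ : ∀ a b c d : ⋀[ℂ]^3 (Fin n → ℂ),
      ξm (symMul (wedgeTwo n a b) (wedgeTwo n c d)) =
        mulSix n a b ⊗ₜ[ℂ] wedgeTwo n c d + mulSix n c d ⊗ₜ[ℂ] wedgeTwo n a b) :
    ξm (Ψ (wSixSq n)) = (1296 : ℂ) • (topSix n ⊗ₜ[ℂ] wSixTwo n) ∧ ξm (Ψ (wSixSq n)) ≠ 0 := by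
  have key : ξm (Ψ (wSixSq n)) = (1296 : ℂ) • (topSix n ⊗ₜ[ℂ] wSixTwo n) := by
    have e1 : ξm (Ψ (wSixSq n)) = ∑ σ, ∑ τ,
        (((XiPsi.sg σ * XiPsi.sg τ) •
          (mulSix n (triA n σ) (triB n σ) ⊗ₜ[ℂ] wedgeTwo n (triA n τ) (triB n τ))
        + (XiPsi.sg τ * XiPsi.sg σ) •
          (mulSix n (triA n τ) (triB n τ) ⊗ₜ[ℂ] wedgeTwo n (triA n σ) (triB n σ)))
        + (XiPsi.U n σ (τ * XiPsi.bs) + XiPsi.U n (σ * XiPsi.bs) τ)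
        + (XiPsi.U n σ τ + XiPsi.U n (σ * XiPsi.bs) (τ * XiPsi.bs))) := by
      simp only [wSixSq, map_sum, map_smul, hΨ, map_add, map_sub, hξ]
      refine Finset.sum_congr rfl fun σ _ => Finset.sum_congr rfl fun τ _ => ?_
      have hs : (((Equiv.Perm.sign σ * Equiv.Perm.sign τ : ℤˣ) : ℤ) : ℂ)
          = XiPsi.sg σ * XiPsi.sg τ := by simp [XiPsi.sg]
      rw [hs]
      simp only [XiPsi.U, XiPsi.triA_bs, XiPsi.triB_bs, XiPsi.sg_mul, XiPsi.sg_bs]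
      module
    rw [e1]
    simp only [Finset.sum_add_distrib]
    have c2 : ∑ σ, ∑ τ, (XiPsi.sg τ * XiPsi.sg σ) •
          (mulSix n (triA n τ) (triB n τ) ⊗ₜ[ℂ] wedgeTwo n (triA n σ) (triB n σ)) =
          (720 : ℂ) • (topSix n ⊗ₜ[ℂ] wSixTwo n) := by
      rw [Finset.sum_comm]; exact XiPsi.sum1 n
    have c3 : ∑ σ, ∑ τ, XiPsi.U n σ (τ * XiPsi.bs) =
        (-36 : ℂ) • (topSix n ⊗ₜ[ℂ] wSixTwo n) := by
      rw [← XiPsi.sum_U]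
      exact Finset.sum_congr rfl fun σ _ => XiPsi.sum_bs (fun τ => XiPsi.U n σ τ)
    have c4 : ∑ σ, ∑ τ, XiPsi.U n (σ * XiPsi.bs) τ =
        (-36 : ℂ) • (topSix n ⊗ₜ[ℂ] wSixTwo n) := by
      rw [← XiPsi.sum_U]
      exact XiPsi.sum_bs (fun σ => ∑ τ, XiPsi.U n σ τ)
    have c5 : ∑ σ, ∑ τ, XiPsi.U n (σ * XiPsi.bs) (τ * XiPsi.bs) =
        (-36 : ℂ) • (topSix n ⊗ₜ[ℂ] wSixTwo n) := by
      rw [← c3]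
      exact XiPsi.sum_bs (fun σ => ∑ τ, XiPsi.U n σ (τ * XiPsi.bs))
    exact XiPsi.arith _ _ _ _ _ _ _ (XiPsi.sum1 n) c2 c3 c4 (XiPsi.sum_U n) c5
  refine ⟨key, ?_⟩
  rw [key]
  exact XiPsi.tmul_ne _ _ (XiPsi.topSix_ne n hn) (XiPsi.wSix_ne n hn) _ (by norm_num)
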